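/- Let n ≥ 1 be an integer and set m = ⌊n/2⌋. Let E : ℕ → ℚ be any function satisfying Σ_{k=0}^{m−1} E(k) = C(n,2). Then 3·C(n,4) − Σ_{k=0}^{m−1} k·(n−2−k)·E(k) = 2·Σ_{k=0}^{m−2} Σ_{i=0}^{k} (k+1−i)·E(i) − (1/2)·C(n,2)·⌊(n−2)/2⌋ − (1/2)·(1+(−1)^n)·Σ_{i=0}^{m−2} (m−1−i)·E(i). (This is the algebraic identity, used in the paper's appendix, showing that the expression cr(D) = 3·C(n,4) − Σ_k k(n−2−k)E_k for the number of crossings of a good drawing of K_n in terms of its numbers E_k of k-edges is equivalent to the formulation cr(D) = 2·Σ_{k=0}^{⌊n/2⌋−2} E_{≤≤k}(D) − (1/2)·C(n,2)·⌊(n−2)/2⌋ − (1/2)(1+(−1)^n)·E_{≤≤⌊n/2⌋−2}(D).) -/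

import Mathlib

open Finset

theorem aux_double (E : ℕ → ℚ) (M : ℕ) :
    ∑ k ∈ range M, ∑ i ∈ range (k + 1), ((k : ℚ) + 1 - (i : ℚ)) * E i =
      ∑ i ∈ range (M + 1), ((M : ℚ) - i) * ((M : ℚ) - i + 1) / 2 * E i := by
  induction M with
  | zero => simp
  | succ M ih =>
    rw [sum_range_succ, ih, sum_range_succ _ (M + 1), ← sum_add_distrib]
    push_cast
    rw [sub_self, zero_mul, zero_div, zero_mul, add_zero]
    apply sum_congr rfl
    intro i _
    ring

theorem aux_single (E : ℕ → ℚ) (M : ℕ) :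
    ∑ i ∈ range M, (((M + 1 : ℕ) : ℚ) - 1 - (i : ℚ)) * E i =
      ∑ i ∈ range (M + 1), ((M : ℚ) - i) * E i := by
  rw [sum_range_succ, sub_self, zero_mul, add_zero]
  apply sum_congr rfl
  intro i _
  push_cast
  ring

theorem aux_choose (p : ℕ) :
    3 * ((p + 2).choose 4 : ℚ) = ((p + 2).choose 2 : ℚ) * p * (p - 1) / 4 := by
  have h1 := Nat.choose_succ_right_eq (p + 2) 2
  have h2 := Nat.choose_succ_right_eq (p + 2) 3
  rcases p with _ | p
  · simp [Nat.choose]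
  · have e1 : p + 1 + 2 - 2 = p + 1 := by omega
    have e2 : p + 1 + 2 - 3 = p := by omega
    rw [e1] at h1
    rw [e2] at h2
    have h1' : ((p + 1 + 2).choose 3 : ℚ) * 3 = ((p + 1 + 2).choose 2 : ℚ) * (p + 1) := by
      exact_mod_cast h1
    have h2' : ((p + 1 + 2).choose 4 : ℚ) * 4 = ((p + 1 + 2).choose 3 : ℚ) * p := by
      exact_mod_cast h2
    push_cast
    linear_combination (3 / 4 : ℚ) * h2' + (p / 4 : ℚ) * h1'

/-- The algebraic identity (from the paper's appendix) showing that
`cr(D) = 3·C(n,4) − Σ_k k(n−2−k)E_k` is equivalent to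
`cr(D) = 2·Σ_{k=0}^{⌊n/2⌋−2} E_{≤≤k} − (1/2)·C(n,2)·⌊(n−2)/2⌋
        − (1/2)(1+(−1)^n)·E_{≤≤⌊n/2⌋−2}`,
for an arbitrary rational sequence `E` with `Σ_{k=0}^{⌊n/2⌋−1} E k = C(n,2)`. -/
theorem stmt0 (n : ℕ) (hn : 1 ≤ n) (E : ℕ → ℚ)
    (hE : ∑ k ∈ range (n / 2), E k = (n.choose 2 : ℚ)) :
    3 * (n.choose 4 : ℚ) -
        ∑ k ∈ range (n / 2), (k : ℚ) * ((n : ℚ) - 2 - (k : ℚ)) * E k =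
      2 * ∑ k ∈ range (n / 2 - 1), ∑ i ∈ range (k + 1), ((k : ℚ) + 1 - (i : ℚ)) * E i
        - (1 / 2 : ℚ) * (n.choose 2 : ℚ) * (((n - 2) / 2 : ℕ) : ℚ)
        - (1 / 2 : ℚ) * (1 + (-1 : ℚ) ^ n) *
            ∑ i ∈ range (n / 2 - 1), (((n / 2 : ℕ) : ℚ) - 1 - (i : ℚ)) * E i := by
  obtain rfl | ⟨M, rfl | rfl⟩ : n = 1 ∨ ∃ M, n = 2 * M + 2 ∨ n = 2 * M + 1 + 2 := by
    by_cases h : n = 1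
    · exact Or.inl h
    · exact Or.inr ⟨n / 2 - 1, by omega⟩
  · simp [Nat.choose]
  · have e1 : (2 * M + 2) / 2 = M + 1 := by omega
    have e2 : (2 * M + 2 - 2) / 2 = M := by omega
    have e3 : (-1 : ℚ) ^ (2 * M + 2) = 1 := Even.neg_one_pow ⟨M + 1, by ring⟩
    rw [e1] at hE
    rw [e1, e2, e3, Nat.add_sub_cancel, aux_double, aux_single, aux_choose, ← hE]
    have key : ∑ k ∈ range (M + 1), (k : ℚ) * (((2 * M + 2 : ℕ) : ℚ) - 2 - (k : ℚ)) * E k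
        + 2 * ∑ i ∈ range (M + 1), ((M : ℚ) - i) * ((M : ℚ) - i + 1) / 2 * E i
        - ∑ i ∈ range (M + 1), ((M : ℚ) - i) * E i
        = (M : ℚ) ^ 2 * ∑ k ∈ range (M + 1), E k := by
      rw [mul_sum, mul_sum, ← sum_add_distrib, ← sum_sub_distrib]
      apply sum_congr rfl
      intro i _
      push_cast
      ring
    push_cast at key ⊢
    linear_combination -key
  · have e1 : (2 * M + 1 + 2) / 2 = M + 1 := by omega
    have e2 : (2 * M + 1 + 2 - 2) / 2 = M := by omega
    have e3 : (-1 : ℚ) ^ (2 * M + 1 + 2) = -1 := Odd.neg_one_pow ⟨M + 1, by ring⟩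
    rw [e1] at hE
    rw [e1, e2, e3, Nat.add_sub_cancel, aux_double, aux_single, aux_choose, ← hE]
    have key : ∑ k ∈ range (M + 1), (k : ℚ) * (((2 * M + 1 + 2 : ℕ) : ℚ) - 2 - (k : ℚ)) * E k
        + 2 * ∑ i ∈ range (M + 1), ((M : ℚ) - i) * ((M : ℚ) - i + 1) / 2 * E i
        = (M : ℚ) * (M + 1) * ∑ k ∈ range (M + 1), E k := by
      rw [mul_sum, mul_sum, ← sum_add_distrib]
      apply sum_congr rfl
      intro i _
      push_cast
      ring
    push_cast at key ⊢
    linear_combination -key
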